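/- Fix i₀ ∈ V and, for β ∈ D_V^W, define β̃ ∈ ℝ^V by β̃_i = β_i − 1_{i=i₀}/(2·(H_β^{-1})(i₀,i₀)). Then for every λ ∈ [0,∞)^V, ∫ exp(−⟨λ,β̃⟩) ν_V^W(dβ) = exp( −(1/2)·Σ_{i≠j} W_{ij}(√((1+λ_i)(1+λ_j)) − 1) ) · ∏_{i∈V∖{i₀}} (1+λ_i)^{−1/2}. -/

import Mathlib

open MeasureTheory Matrix

noncomputable section

/-- The Schrödinger operator `H_β = 2·diag(β) − W`. -/
def Hmat {V : Type*} [Fintype V] [DecidableEq V] (W : Matrix V V ℝ) (β : V → ℝ) :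
    Matrix V V ℝ :=
  2 • Matrix.diagonal β - W

/-- Density of the measure `ν_V^{W,η}` with respect to Lebesgue measure. -/
def nuDens {V : Type*} [Fintype V] [DecidableEq V] (W : Matrix V V ℝ) (η : V → ℝ)
    (β : V → ℝ) : ENNReal :=
  Set.indicator {β : V → ℝ | (Hmat W β).PosDef}
    (fun β => ENNReal.ofReal
      ((2 / Real.pi) ^ ((Fintype.card V : ℝ) / 2) *
        Real.exp (-(1 / 2) * ((1 : V → ℝ) ⬝ᵥ (Hmat W β).mulVec 1
            + η ⬝ᵥ (Hmat W β)⁻¹.mulVec η) + η ⬝ᵥ (1 : V → ℝ)) /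
        Real.sqrt (Hmat W β).det)) β

/-- The measure `ν_V^{W,η}`. -/
def nuMeas {V : Type*} [Fintype V] [DecidableEq V] (W : Matrix V V ℝ) (η : V → ℝ) :
    Measure (V → ℝ) :=
  volume.withDensity (nuDens W η)

/-- The graph on `V` with an edge `{i,j}` whenever `W i j > 0`. -/
def graphOf {V : Type*} (W : Matrix V V ℝ) : SimpleGraph V :=
  SimpleGraph.fromRel (fun i j => 0 < W i j)

set_option linter.unusedSectionVars false

lemma aux_gauss_Ioi (a : ℝ) (ha : 0 < a) :
    ∫⁻ t in Set.Ioi (0:ℝ), ENNReal.ofReal (Real.exp (-(1/2) * (a*t)^2))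
      = ENNReal.ofReal (Real.sqrt (Real.pi / 2) / a) := by
  have h1 := integral_gaussian_Ioi (a^2/2)
  have hint : Integrable (fun t : ℝ => Real.exp (-(a^2/2) * t^2)) :=
    integrable_exp_neg_mul_sq (by positivity)
  have h2 := ofReal_integral_eq_lintegral_ofReal (hint.restrict (s := Set.Ioi (0:ℝ)))
    (Filter.Eventually.of_forall fun t => (Real.exp_pos _).le)
  have e : ∀ t : ℝ, -(1/2) * (a*t)^2 = -(a^2/2) * t^2 := fun t => by ring
  simp_rw [e]
  rw [← h2, h1]
  congr 1
  have : Real.pi / (a^2/2) = (Real.pi/2) * (2/a)^2 := by field_simp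
  rw [this, Real.sqrt_mul (by positivity), Real.sqrt_sq (by positivity)]
  field_simp

lemma aux_gauss_full :
    ∫⁻ t : ℝ, ENNReal.ofReal (Real.exp (-(1/2) * t^2))
      = ENNReal.ofReal (2 * Real.sqrt (Real.pi / 2)) := by
  have h1 := integral_gaussian (1/2)
  have hint : Integrable (fun t : ℝ => Real.exp (-(1/2) * t^2)) :=
    integrable_exp_neg_mul_sq (by positivity)
  have h2 := ofReal_integral_eq_lintegral_ofReal hint
    (Filter.Eventually.of_forall fun t => (Real.exp_pos _).le)
  rw [← h2, h1]
  congr 1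
  have : Real.pi / (1/2) = (Real.pi/2) * (2)^2 := by field_simp
  rw [this, Real.sqrt_mul (by positivity), Real.sqrt_sq (by positivity)]
  ring

/-- Cauchy–Schlömilch -/
lemma aux_CS (a b : ℝ) (ha : 0 < a) (hb : 0 < b) :
    ∫⁻ t in Set.Ioi (0:ℝ), ENNReal.ofReal (Real.exp (-(1/2) * (a*t - b/t)^2))
      = ENNReal.ofReal (Real.sqrt (Real.pi / 2) / a) := by
  set I := ∫⁻ t in Set.Ioi (0:ℝ), ENNReal.ofReal (Real.exp (-(1/2) * (a*t - b/t)^2)) with hI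
  -- substitution to the full line
  have hinj : Set.InjOn (fun t : ℝ => a*t - b/t) (Set.Ioi 0) := by
    apply StrictMonoOn.injOn
    intro x hx y hy hxy
    have hx' : 0 < x := hx
    have : b / y < b / x := by gcongr
    have : a * x < a * y := by gcongr
    simp only
    linarith
  have himg : (fun t : ℝ => a*t - b/t) '' (Set.Ioi 0) = Set.univ := by
    apply Set.eq_univ_of_forall
    intro y
    set r := Real.sqrt (y^2 + 4*a*b) with hr
    have hr2 : r^2 = y^2 + 4*a*b := Real.sq_sqrt (by positivity)
    have hry : |y| < r := by
      rw [hr, ← Real.sqrt_sq_eq_abs]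
      apply Real.sqrt_lt_sqrt (by positivity)
      have : 0 < a * b := by positivity
      linarith
    have hpos : 0 < y + r := by have := neg_abs_le y; linarith
    refine ⟨(y + r)/(2*a), by simp only [Set.mem_Ioi]; positivity, ?_⟩
    simp only
    field_simp
    nlinarith
  have hd : ∀ t ∈ Set.Ioi (0:ℝ), HasDerivWithinAt (fun t : ℝ => a*t - b/t) (a + b/t^2)
      (Set.Ioi 0) t := by
    intro t ht
    have ht' : t ≠ 0 := (ne_of_gt ht)
    apply HasDerivAt.hasDerivWithinAt
    have h1 : HasDerivAt (fun t : ℝ => a*t) a t := by simpa using (hasDerivAt_id t).const_mul a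
    have h2 := (hasDerivAt_inv ht').const_mul b
    have h3 := h1.sub h2
    convert! h3 using 1
    field_simp
    ring
  have hA := lintegral_image_eq_lintegral_abs_deriv_mul measurableSet_Ioi hd hinj
    (fun t => ENNReal.ofReal (Real.exp (-(1/2) * t^2)))
  rw [himg, Measure.restrict_univ, aux_gauss_full] at hA
  -- involution
  have hinj2 : Set.InjOn (fun t : ℝ => b/(a*t)) (Set.Ioi 0) := by
    intro x hx y hy hxy
    have hx' : 0 < x := hx
    have hy' : 0 < y := hy
    simp only at hxy
    field_simp at hxy
    exact hxy.symm
  have himg2 : (fun t : ℝ => b/(a*t)) '' (Set.Ioi 0) = Set.Ioi 0 := by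
    ext y
    constructor
    · rintro ⟨x, hx, rfl⟩
      have hx' : 0 < x := hx
      simp only [Set.mem_Ioi]; positivity
    · intro hy
      have hy' : 0 < y := hy
      refine ⟨b/(a*y), by simp only [Set.mem_Ioi]; positivity, ?_⟩
      simp only
      field_simp
  have hd2 : ∀ t ∈ Set.Ioi (0:ℝ), HasDerivWithinAt (fun t : ℝ => b/(a*t)) (-(b/(a*t^2)))
      (Set.Ioi 0) t := by
    intro t ht
    have ht' : t ≠ 0 := (ne_of_gt ht)
    apply HasDerivAt.hasDerivWithinAt
    have h2 := (hasDerivAt_inv ht').const_mul (b/a)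
    convert! h2 using 1
    · ext t; field_simp
    · field_simp
  have hB := lintegral_image_eq_lintegral_abs_deriv_mul measurableSet_Ioi hd2 hinj2
    (fun t => ENNReal.ofReal (Real.exp (-(1/2) * (a*t - b/t)^2)))
  rw [himg2, ← hI] at hB
  have hB' : ENNReal.ofReal a * I = ∫⁻ t in Set.Ioi (0:ℝ), ENNReal.ofReal (b/t^2) *
      ENNReal.ofReal (Real.exp (-(1/2) * (a*t - b/t)^2)) := by
    rw [hB, ← lintegral_const_mul' _ _ ENNReal.ofReal_ne_top]
    apply setLIntegral_congr_fun measurableSet_Ioi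
    intro t ht
    have ht' : 0 < t := ht
    simp only
    rw [← mul_assoc, ← ENNReal.ofReal_mul ha.le]
    congr 2
    · rw [abs_neg, abs_of_pos (by positivity)]; field_simp
    · congr 2; 
      have : a * (b/(a*t)) - b/(b/(a*t)) = -(a*t - b/t) := by field_simp; ring
      rw [this, neg_sq]
  have hA' : ENNReal.ofReal (2 * Real.sqrt (Real.pi / 2)) = ENNReal.ofReal (2 * a) * I := by
    rw [hA, two_mul, ENNReal.ofReal_add ha.le ha.le, add_mul]
    nth_rewrite 2 [hB']
    rw [hI, ← lintegral_const_mul' _ _ ENNReal.ofReal_ne_top, ← lintegral_add_left (by fun_prop)]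
    apply setLIntegral_congr_fun measurableSet_Ioi
    intro t ht
    have ht' : 0 < t := ht
    simp only
    rw [← add_mul, ← ENNReal.ofReal_add (by positivity) (by positivity),
      abs_of_pos (by positivity)]
  have : I = ENNReal.ofReal (1/(2*a)) * (ENNReal.ofReal (2 * a) * I) := by
    rw [← mul_assoc, ← ENNReal.ofReal_mul (by positivity)]
    rw [show 1/(2*a)*(2*a) = 1 by field_simp]; simp
  rw [this, ← hA', ← ENNReal.ofReal_mul (by positivity)]
  congr 1
  field_simp

lemma aux_IG (a b : ℝ) (ha : 0 < a) (hb : 0 ≤ b) :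
    ∫⁻ s in Set.Ioi (0:ℝ), ENNReal.ofReal (1/2) *
        ENNReal.ofReal (Real.exp (-(1/2) * (a^2 * s + b^2 / s)) / Real.sqrt s)
      = ENNReal.ofReal (Real.sqrt (Real.pi / 2) / a * Real.exp (-(a*b))) := by
  have hinj : Set.InjOn (fun t : ℝ => t^2) (Set.Ioi 0) := by
    intro x hx y hy hxy
    have hx' : 0 < x := hx
    have hy' : 0 < y := hy
    simp only at hxy
    exact (pow_left_inj₀ hx'.le hy'.le two_ne_zero).1 hxy
  have himg : (fun t : ℝ => t^2) '' (Set.Ioi 0) = Set.Ioi 0 := by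
    ext y
    constructor
    · rintro ⟨x, hx, rfl⟩
      have hx' : 0 < x := hx
      simp only [Set.mem_Ioi]; positivity
    · intro hy
      have hy' : 0 < y := hy
      exact ⟨Real.sqrt y, Real.sqrt_pos.2 hy', Real.sq_sqrt hy'.le⟩
  have hd : ∀ t ∈ Set.Ioi (0:ℝ), HasDerivWithinAt (fun t : ℝ => t^2) (2*t) (Set.Ioi 0) t := by
    intro t ht
    apply HasDerivAt.hasDerivWithinAt
    simpa using hasDerivAt_pow 2 t
  have hA := lintegral_image_eq_lintegral_abs_deriv_mul measurableSet_Ioi hd hinj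
    (fun s => ENNReal.ofReal (1/2) *
        ENNReal.ofReal (Real.exp (-(1/2) * (a^2 * s + b^2 / s)) / Real.sqrt s))
  rw [himg] at hA
  rw [hA]
  have hC : ∫⁻ t in Set.Ioi (0:ℝ), ENNReal.ofReal (Real.exp (-(1/2) * (a*t - b/t)^2))
      = ENNReal.ofReal (Real.sqrt (Real.pi / 2) / a) := by
    rcases hb.eq_or_lt with h | h
    · subst h
      simpa using aux_gauss_Ioi a ha
    · exact aux_CS a b ha h
  rw [mul_comm (Real.sqrt (Real.pi / 2) / a), ENNReal.ofReal_mul (by positivity), ← hC,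
    ← lintegral_const_mul' _ _ ENNReal.ofReal_ne_top]
  apply setLIntegral_congr_fun measurableSet_Ioi
  intro t ht
  have ht' : 0 < t := ht
  simp only
  rw [← ENNReal.ofReal_mul (by positivity), ← ENNReal.ofReal_mul (by positivity),
    ← ENNReal.ofReal_mul (by positivity), abs_of_pos (by positivity), Real.sqrt_sq ht'.le,
    ← Real.exp_add]
  congr 1
  have : -(1/2) * (a^2 * t^2 + b^2 / t^2) = -(a*b) + -(1/2) * (a*t - b/t)^2 := by
    field_simp; ring
  rw [this]
  field_simp

lemma Hmat_apply {V : Type*} [Fintype V] [DecidableEq V] (W : Matrix V V ℝ) (β : V → ℝ) (i j : V) :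
    Hmat W β i j = (if i = j then 2 * β i else 0) - W i j := by
  rw [Hmat, Matrix.sub_apply, Matrix.smul_apply, Matrix.diagonal_apply]
  split_ifs <;> simp

section blocks
variable {U : Type*} [Fintype U] [DecidableEq U]

/-- coupling vector -/
def wvec (W : Matrix (Unit ⊕ U) (Unit ⊕ U) ℝ) : U → ℝ := fun j => W (Sum.inr j) (Sum.inl ())

/-- Schur constant -/
def cS (W : Matrix (Unit ⊕ U) (Unit ⊕ U) ℝ) (y : U → ℝ) : ℝ :=
  wvec W ⬝ᵥ ((Hmat W.toBlocks₂₂ y)⁻¹ *ᵥ wvec W)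

lemma Hmat_blocks (W : Matrix (Unit ⊕ U) (Unit ⊕ U) ℝ) (hs : W.IsSymm)
    (h0 : W (Sum.inl ()) (Sum.inl ()) = 0) (x : ℝ) (y : U → ℝ) :
    Hmat W (Sum.elim (fun _ => x) y) =
      fromBlocks (of fun _ _ => 2 * x) (of fun _ j => -wvec W j)
        (of fun _ j => -wvec W j)ᴴ (Hmat W.toBlocks₂₂ y) := by
  ext i j
  rcases i with i | i <;> rcases j with j | j
  · simp [Hmat_apply, h0]
  · simp [Hmat_apply, wvec]
    exact hs.apply _ _
  · simp [Hmat_apply, wvec]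
  · simp [Hmat_apply, toBlocks₂₂]

lemma Hmat_isHermitian {V : Type*} [Fintype V] [DecidableEq V] (W : Matrix V V ℝ) (hs : W.IsSymm)
    (β : V → ℝ) : (Hmat W β).IsHermitian := by
  ext i j
  have := hs.apply i j
  by_cases h : i = j
  · subst h; simp [Hmat_apply]
  · simp [Hmat_apply, h, Ne.symm h, this]

lemma schur_entry (v : U → ℝ) (D : Matrix U U ℝ) (x : ℝ) :
    ((of fun (_ : Unit) (_ : Unit) => 2 * x) - (of fun (_ : Unit) j => -v j) * D⁻¹ *
      (of fun (_ : Unit) j => -v j)ᴴ) = of fun _ _ => 2 * x - v ⬝ᵥ (D⁻¹ *ᵥ v) := by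
  ext i j
  rw [Matrix.mul_assoc]
  simp [Matrix.mul_apply, dotProduct, mulVec]

lemma Hmat_det (W : Matrix (Unit ⊕ U) (Unit ⊕ U) ℝ) (hs : W.IsSymm)
    (h0 : W (Sum.inl ()) (Sum.inl ()) = 0) (x : ℝ) (y : U → ℝ)
    (hD : (Hmat W.toBlocks₂₂ y).PosDef) :
    (Hmat W (Sum.elim (fun _ => x) y)).det = (Hmat W.toBlocks₂₂ y).det * (2 * x - cS W y) := by
  rw [Hmat_blocks W hs h0]
  have := hD.isUnit.invertible
  rw [det_fromBlocks₂₂, invOf_eq_nonsing_inv, schur_entry]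
  simp [cS]

lemma Hmat_posDef (W : Matrix (Unit ⊕ U) (Unit ⊕ U) ℝ) (hs : W.IsSymm)
    (h0 : W (Sum.inl ()) (Sum.inl ()) = 0) (x : ℝ) (y : U → ℝ)
    (hD : (Hmat W.toBlocks₂₂ y).PosDef) :
    (Hmat W (Sum.elim (fun _ => x) y)).PosDef ↔ 0 < 2 * x - cS W y := by
  have := hD.isUnit.invertible
  have hps : (Hmat W (Sum.elim (fun _ => x) y)).PosSemidef ↔ 0 ≤ 2 * x - cS W y := by
    rw [Hmat_blocks W hs h0, PosDef.fromBlocks₂₂ _ _ hD, schur_entry]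
    constructor
    · intro h
      exact h.diag_nonneg (i := ())
    · intro h
      have : (of fun (_ : Unit) (_ : Unit) => 2 * x - wvec W ⬝ᵥ ((Hmat W.toBlocks₂₂ y)⁻¹ *ᵥ wvec W))
         = Matrix.diagonal (fun _ => 2 * x - cS W y) := by
        ext i j; simp [cS]
      rw [this]
      exact PosSemidef.diagonal (fun _ => h)
  have hdet := Hmat_det W hs h0 x y hD
  have hDd := hD.det_pos
  constructor
  · intro h
    have := h.det_pos
    rw [hdet] at this
    exact (pos_iff_pos_of_mul_pos this).1 hDd
  · intro h
    rw [(hps.2 h.le).posDef_iff_det_ne_zero, hdet]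
    positivity

lemma Hmat_sub_posDef (W : Matrix (Unit ⊕ U) (Unit ⊕ U) ℝ) (hs : W.IsSymm)
    (h0 : W (Sum.inl ()) (Sum.inl ()) = 0) (x : ℝ) (y : U → ℝ)
    (h : (Hmat W (Sum.elim (fun _ => x) y)).PosDef) : (Hmat W.toBlocks₂₂ y).PosDef := by
  rw [Hmat_blocks W hs h0] at h
  exact h.submatrix (e := Sum.inr) Sum.inr_injective

lemma Hmat_inv_mulVec (W : Matrix (Unit ⊕ U) (Unit ⊕ U) ℝ) (hs : W.IsSymm)
    (h0 : W (Sum.inl ()) (Sum.inl ()) = 0) (x : ℝ) (y : U → ℝ)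
    (hD : (Hmat W.toBlocks₂₂ y).PosDef) (hpos : 0 < 2 * x - cS W y) (p : ℝ) (q : U → ℝ) :
    (Hmat W (Sum.elim (fun _ => x) y))⁻¹ *ᵥ (Sum.elim (fun _ => p) q) =
      Sum.elim (fun _ => (p + wvec W ⬝ᵥ ((Hmat W.toBlocks₂₂ y)⁻¹ *ᵥ q)) / (2 * x - cS W y))
        ((Hmat W.toBlocks₂₂ y)⁻¹ *ᵥ q +
          ((p + wvec W ⬝ᵥ ((Hmat W.toBlocks₂₂ y)⁻¹ *ᵥ q)) / (2 * x - cS W y)) •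
            ((Hmat W.toBlocks₂₂ y)⁻¹ *ᵥ wvec W)) := by
  have hH := (Hmat_posDef W hs h0 x y hD).2 hpos
  have hu := (Matrix.isUnit_iff_isUnit_det _).1 hH.isUnit
  have huD := (Matrix.isUnit_iff_isUnit_det _).1 hD.isUnit
  set r := (p + wvec W ⬝ᵥ ((Hmat W.toBlocks₂₂ y)⁻¹ *ᵥ q)) / (2 * x - cS W y) with hr
  have key : Hmat W (Sum.elim (fun _ => x) y) *ᵥ (Sum.elim (fun _ => r)
      ((Hmat W.toBlocks₂₂ y)⁻¹ *ᵥ q + r • ((Hmat W.toBlocks₂₂ y)⁻¹ *ᵥ wvec W)))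
      = Sum.elim (fun _ => p) q := by
    rw [Hmat_blocks W hs h0, fromBlocks_mulVec]
    congr 1
    · ext i
      have e1 : ((of fun (_ : Unit) (_ : Unit) => 2 * x) *ᵥ fun _ => r) i = 2 * x * r := by
        simp [mulVec, dotProduct]
      have e2 : ∀ z : U → ℝ, ((of fun (_ : Unit) j => -wvec W j) *ᵥ z) i = - (wvec W ⬝ᵥ z) := by
        intro z; simp [mulVec, dotProduct]
      simp only [Sum.elim_comp_inl, Sum.elim_comp_inr, Pi.add_apply]
      rw [e1, e2, dotProduct_add, dotProduct_smul]
      change _ + -(_ + r • cS W y) = _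
      rw [smul_eq_mul]
      have : r * (2 * x - cS W y) = p + wvec W ⬝ᵥ ((Hmat W.toBlocks₂₂ y)⁻¹ *ᵥ q) := by
        rw [hr]; field_simp
      linarith
    · simp only [Sum.elim_comp_inl, Sum.elim_comp_inr]
      rw [mulVec_add, mulVec_smul, mulVec_mulVec, mulVec_mulVec, mul_nonsing_inv _ huD,
        one_mulVec, one_mulVec]
      ext j
      simp [mulVec, dotProduct]
      ring
  rw [← key, mulVec_mulVec, nonsing_inv_mul _ hu, one_mulVec]

lemma inv_nonneg_of_M {V : Type*} [Fintype V] [DecidableEq V] (W : Matrix V V ℝ)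
    (hnn : ∀ i j, 0 ≤ W i j) (y : V → ℝ)
    (hD : (Hmat W y).PosDef) (q : V → ℝ) (hq : ∀ i, 0 ≤ q i) (i : V) :
    0 ≤ ((Hmat W y)⁻¹ *ᵥ q) i := by
  have hu := (Matrix.isUnit_iff_isUnit_det _).1 hD.isUnit
  set x := (Hmat W y)⁻¹ *ᵥ q with hx
  have hHx : Hmat W y *ᵥ x = q := by
    rw [hx, mulVec_mulVec, mul_nonsing_inv _ hu, one_mulVec]
  let m : V → ℝ := fun i => max (-x i) 0
  let n : V → ℝ := fun i => max (x i) 0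
  have hxmn : x = n - m := by
    ext i; simp only [m, n, Pi.sub_apply]
    rcases le_total (x i) 0 with h | h
    · rw [max_eq_right h, max_eq_left (by linarith)]; ring
    · rw [max_eq_left h, max_eq_right (by linarith)]; ring
  have hm : ∀ i, 0 ≤ m i := fun i => le_max_right _ _
  have hn : ∀ i, 0 ≤ n i := fun i => le_max_right _ _
  have hmn : ∀ i, m i * n i = 0 := by
    intro i; simp only [m, n]
    rcases le_total (x i) 0 with h | h
    · rw [max_eq_right h]; ring
    · rw [max_eq_right (a := -x i) (by linarith)]; ring
  have h1 : 0 ≤ m ⬝ᵥ (Hmat W y *ᵥ x) := by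
    rw [hHx]; exact Finset.sum_nonneg fun i _ => mul_nonneg (hm i) (hq i)
  have h2 : m ⬝ᵥ (Hmat W y *ᵥ n) ≤ 0 := by
    simp only [dotProduct, mulVec, Finset.mul_sum]
    apply Finset.sum_nonpos
    intro i _
    apply Finset.sum_nonpos
    intro j _
    by_cases h : i = j
    · subst h
      have := hmn i
      calc m i * (Hmat W y i i * n i) = Hmat W y i i * (m i * n i) := by ring
        _ ≤ 0 := by rw [this]; simp
    · have : Hmat W y i j = - W i j := by simp [Hmat_apply, h]
      rw [this]
      have := mul_nonneg (hm i) (mul_nonneg (hnn i j) (hn j))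
      linarith
  rw [hxmn, mulVec_sub, dotProduct_sub] at h1
  by_contra hneg
  push Not at hneg
  have hm0 : m ≠ 0 := by
    intro h
    have := congrFun h i
    simp only [m, Pi.zero_apply] at this
    have h3 := le_max_left (-x i) 0
    linarith
  have := hD.dotProduct_mulVec_pos hm0
  simp only [star_trivial] at this
  linarith

end blocks

section meas
variable {V : Type*} [Fintype V] [DecidableEq V]

lemma Hmat_continuous (W : Matrix V V ℝ) : Continuous (Hmat W) := by
  refine continuous_matrix fun i j => ?_
  simp_rw [Hmat_apply]
  split_ifs <;> fun_prop

lemma measurable_det (W : Matrix V V ℝ) : Measurable fun β => (Hmat W β).det :=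
  (Hmat_continuous W).matrix_det.measurable

lemma measurable_inv (W : Matrix V V ℝ) (i j : V) : Measurable fun β => (Hmat W β)⁻¹ i j := by
  simp_rw [Matrix.inv_def, Matrix.smul_apply, Ring.inverse_eq_inv', smul_eq_mul]
  refine (measurable_det W).inv.mul ?_
  exact ((Hmat_continuous W).matrix_adjugate.matrix_elem i j).measurable

lemma measurable_inv_mulVec (W : Matrix V V ℝ) (q : V → ℝ) (i : V) :
    Measurable fun β => ((Hmat W β)⁻¹ *ᵥ q) i := by
  simp only [mulVec, dotProduct]
  exact Finset.measurable_sum _ fun j _ => (measurable_inv W i j).mul_const _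

lemma measurable_quad (W : Matrix V V ℝ) (p q : V → ℝ) :
    Measurable fun β => p ⬝ᵥ ((Hmat W β)⁻¹ *ᵥ q) := by
  rw [show (fun β => p ⬝ᵥ ((Hmat W β)⁻¹ *ᵥ q)) = fun β => ∑ i, p i * ((Hmat W β)⁻¹ *ᵥ q) i from rfl]
  exact Finset.measurable_sum _ fun j _ => (measurable_inv_mulVec W q j).const_mul _

lemma measurableSet_posDef (W : Matrix V V ℝ) (hs : W.IsSymm) :
    MeasurableSet {β : V → ℝ | (Hmat W β).PosDef} := by
  have : {β : V → ℝ | (Hmat W β).PosDef} =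
      (⋂ x : V → ℝ, {β | 0 ≤ x ⬝ᵥ (Hmat W β *ᵥ x)}) ∩ {β | (Hmat W β).det ≠ 0} := by
    ext β
    simp only [Set.mem_ofPred_eq, Set.mem_inter_iff, Set.mem_iInter]
    constructor
    · intro h
      exact ⟨fun x => by simpa using h.posSemidef.dotProduct_mulVec_nonneg x, h.det_pos.ne'⟩
    · rintro ⟨h1, h2⟩
      have : (Hmat W β).PosSemidef := PosSemidef.of_dotProduct_mulVec_nonneg
        (Hmat_isHermitian W hs β) (by simpa using h1)
      exact this.posDef_iff_det_ne_zero.2 h2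
  rw [this]
  refine MeasurableSet.inter (IsClosed.measurableSet ?_) ?_
  · refine isClosed_iInter fun x => isClosed_le continuous_const ?_
    exact continuous_const.dotProduct ((Hmat_continuous W).matrix_mulVec continuous_const)
  · exact (measurable_det W) (measurableSet_singleton 0).compl

end meas

section step
variable {U : Type*} [Fintype U] [DecidableEq U]

lemma lintegral_unit_sum (F : (Unit ⊕ U → ℝ) → ENNReal) (hF : Measurable F) :
    ∫⁻ β, F β = ∫⁻ y : U → ℝ, ∫⁻ x : ℝ, F (Sum.elim (fun _ => x) y) := by
  have h1 := (volume_measurePreserving_sumPiEquivProdPi_symm (fun _ : Unit ⊕ U => ℝ)).lintegral_comp hF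
  rw [← h1]
  have hm : Measurable fun a => F ((MeasurableEquiv.sumPiEquivProdPi fun _ : Unit ⊕ U => ℝ).symm a) :=
    hF.comp (MeasurableEquiv.measurable _)
  rw [Measure.volume_eq_prod, lintegral_prod_symm' _ hm]
  congr 1
  ext y
  have h2 := (volume_preserving_funUnique Unit ℝ).symm.lintegral_comp_emb
    (MeasurableEquiv.measurableEmbedding _)
    (fun u => F ((MeasurableEquiv.sumPiEquivProdPi fun _ : Unit ⊕ U => ℝ).symm (u, y)))
  rw [← h2]
  rfl

lemma one_step (W : Matrix (Unit ⊕ U) (Unit ⊕ U) ℝ) (hs : W.IsSymm)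
    (h0 : W (Sum.inl ()) (Sum.inl ()) = 0) (F : (Unit ⊕ U → ℝ) → ENNReal) (hF : Measurable F) :
    ∫⁻ β, {β | (Hmat W β).PosDef}.indicator F β =
      ∫⁻ y : U → ℝ, {y | (Hmat W.toBlocks₂₂ y).PosDef}.indicator
        (fun y => ∫⁻ s in Set.Ioi (0:ℝ), ENNReal.ofReal (1/2) *
          F (Sum.elim (fun _ => (s + cS W y) / 2) y)) y := by
  rw [lintegral_unit_sum _ (hF.indicator (measurableSet_posDef W hs))]
  congr 1
  ext y
  by_cases hD : (Hmat W.toBlocks₂₂ y).PosDef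
  · rw [Set.indicator_of_mem (by exact hD)]
    have hd : ∀ s ∈ Set.Ioi (0:ℝ), HasDerivWithinAt (fun s : ℝ => (s + cS W y)/2) (1/2)
        (Set.Ioi 0) s := fun s _ =>
      (((hasDerivAt_id s).add_const (cS W y)).div_const 2).hasDerivWithinAt
    have hinj : Set.InjOn (fun s : ℝ => (s + cS W y)/2) (Set.Ioi 0) := by
      intro a _ b _ hab
      simp only at hab
      linarith
    have hA := lintegral_image_eq_lintegral_abs_deriv_mul measurableSet_Ioi hd hinj
      (fun x => F (Sum.elim (fun _ => x) y))
    have himg : (fun s : ℝ => (s + cS W y)/2) '' Set.Ioi 0 = Set.Ioi (cS W y / 2) := by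
      ext x
      simp only [Set.mem_image, Set.mem_Ioi]
      constructor
      · rintro ⟨s, hs, rfl⟩; linarith
      · intro h; exact ⟨2 * x - cS W y, by linarith, by ring⟩
    rw [himg, abs_of_pos (by norm_num)] at hA
    rw [← hA, ← lintegral_indicator measurableSet_Ioi]
    congr 1
    ext x
    have : Sum.elim (fun _ => x) y ∈ {β | (Hmat W β).PosDef} ↔ x ∈ Set.Ioi (cS W y / 2) := by
      rw [Set.mem_ofPred_eq, Hmat_posDef W hs h0 x y hD, Set.mem_Ioi]
      constructor <;> intro h <;> linarith
    by_cases hx : x ∈ Set.Ioi (cS W y / 2)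
    · rw [Set.indicator_of_mem (this.2 hx), Set.indicator_of_mem hx]
    · rw [Set.indicator_of_notMem (this.not.2 hx), Set.indicator_of_notMem hx]
  · rw [Set.indicator_of_notMem (by exact hD)]
    have : ∀ x : ℝ, {β | (Hmat W β).PosDef}.indicator F (Sum.elim (fun _ => x) y) = 0 := by
      intro x
      apply Set.indicator_of_notMem
      intro h
      exact hD (Hmat_sub_posDef W hs h0 x y h)
    simp [this]

end step

section transfer
variable {V V' : Type*} [Fintype V] [DecidableEq V] [Fintype V'] [DecidableEq V']

lemma lintegral_equiv (e : V ≃ V') (F : (V → ℝ) → ENNReal) :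
    ∫⁻ β, F β = ∫⁻ β' : V' → ℝ, F (fun i => β' (e i)) := by
  have h := (volume_measurePreserving_piCongrLeft (fun _ : V => ℝ) e.symm).lintegral_comp_emb
    (MeasurableEquiv.measurableEmbedding _) F
  rw [← h]
  congr 1
  ext β'
  congr 1
  ext i
  conv_lhs => rw [show i = e.symm (e i) by simp]
  simp only [MeasurableEquiv.coe_piCongrLeft]
  exact Equiv.piCongrLeft_apply_apply (fun _ : V => ℝ) e.symm β' (e i)

lemma Hmat_equiv (e : V ≃ V') (W : Matrix V V ℝ) (β' : V' → ℝ) :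
    Hmat W (fun i => β' (e i)) = (Hmat (W.submatrix e.symm e.symm) β').submatrix e e := by
  ext i j
  simp [Hmat_apply]

lemma posDef_equiv (e : V ≃ V') (A : Matrix V' V' ℝ) : (A.submatrix e e).PosDef ↔ A.PosDef := by
  constructor
  · intro h
    have := h.submatrix (e := e.symm) e.symm.injective
    simpa using this
  · intro h; exact h.submatrix e.injective

end transfer

section key

lemma quad_symm {V : Type*} [Fintype V] [DecidableEq V] (W : Matrix V V ℝ) (hs : W.IsSymm)
    (β p q : V → ℝ) : p ⬝ᵥ ((Hmat W β)⁻¹ *ᵥ q) = q ⬝ᵥ ((Hmat W β)⁻¹ *ᵥ p) := by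
  have h : ((Hmat W β)⁻¹)ᵀ = (Hmat W β)⁻¹ := by
    rw [transpose_nonsing_inv]
    congr 1
    simpa [IsHermitian, conjTranspose_eq_transpose_of_trivial] using Hmat_isHermitian W hs β
  rw [dotProduct_mulVec, ← mulVec_transpose, h, dotProduct_comm]

/-- The normalisation statement for the finite type `V`. -/
def KeyStmt (V : Type*) [Fintype V] [DecidableEq V] : Prop :=
  ∀ W : Matrix V V ℝ, W.IsSymm → (∀ i j, 0 ≤ W i j) → (∀ i, W i i = 0) →
    ∀ θ η : V → ℝ, (∀ i, 0 < θ i) → (∀ i, 0 ≤ η i) →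
    ∫⁻ β, {β | (Hmat W β).PosDef}.indicator (fun β => ENNReal.ofReal
      (Real.exp (-(∑ i, θ i ^ 2 * β i) - 1/2 * (η ⬝ᵥ ((Hmat W β)⁻¹ *ᵥ η))) /
        Real.sqrt (Hmat W β).det)) β
      = ENNReal.ofReal (Real.sqrt (Real.pi / 2) ^ Fintype.card V * (∏ i, θ i)⁻¹ *
          Real.exp (-(1/2) * (∑ i, ∑ j, W i j * θ i * θ j) - η ⬝ᵥ θ))

lemma key_equiv {V V' : Type*} [Fintype V] [DecidableEq V] [Fintype V'] [DecidableEq V']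
    (e : V ≃ V') (h : KeyStmt V') : KeyStmt V := by
  intro W hs hnn hd θ η hθ hη
  have h1 := h (W.submatrix e.symm e.symm) (hs.submatrix _) (fun i j => hnn _ _) (fun i => hd _)
    (θ ∘ e.symm) (η ∘ e.symm) (fun i => hθ _) (fun i => hη _)
  rw [lintegral_equiv e]
  have hq : ∀ β' : V' → ℝ, η ⬝ᵥ ((Hmat W (fun i => β' (e i)))⁻¹ *ᵥ η) =
      (η ∘ e.symm) ⬝ᵥ ((Hmat (W.submatrix e.symm e.symm) β')⁻¹ *ᵥ (η ∘ e.symm)) := by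
    intro β'
    rw [Hmat_equiv, inv_submatrix_equiv, submatrix_mulVec_equiv]
    exact Fintype.sum_equiv e _ _ (fun i => by simp)
  convert! h1 using 1
  · congr 1
    ext β'
    by_cases hp : (Hmat (W.submatrix e.symm e.symm) β').PosDef
    · have hp' : (Hmat W (fun i => β' (e i))).PosDef := by
        rw [Hmat_equiv, posDef_equiv]; exact hp
      rw [Set.indicator_of_mem (by exact hp'), Set.indicator_of_mem (by exact hp), hq, Hmat_equiv,
        det_submatrix_equiv_self]
      congr 5
      exact Fintype.sum_equiv e _ _ (fun i => by simp)
    · have hp' : ¬ (Hmat W (fun i => β' (e i))).PosDef := by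
        rw [Hmat_equiv, posDef_equiv]; exact hp
      rw [Set.indicator_of_notMem (by exact hp'), Set.indicator_of_notMem (by exact hp)]
  · congr 2
    · rw [Fintype.card_congr e]
      congr 2
      exact Fintype.prod_equiv e _ _ (fun i => by simp)
    · congr 2
      · congr 1
        exact Fintype.sum_equiv e _ _ (fun i => Fintype.sum_equiv e _ _ (fun j => by simp))
      · exact Fintype.sum_equiv e _ _ (fun i => by simp)

lemma sum_split {U : Type*} [Fintype U] (W : Matrix (Unit ⊕ U) (Unit ⊕ U) ℝ)
    (hs : W.IsSymm) (h0 : W (Sum.inl ()) (Sum.inl ()) = 0) (θ : Unit ⊕ U → ℝ) :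
    ∑ i, ∑ j, W i j * θ i * θ j = 2 * θ (Sum.inl ()) * (wvec W ⬝ᵥ (θ ∘ Sum.inr)) +
      ∑ i, ∑ j, W.toBlocks₂₂ i j * (θ ∘ Sum.inr) i * (θ ∘ Sum.inr) j := by
  have hw : ∀ j, W (Sum.inl ()) (Sum.inr j) = wvec W j := fun j => hs.apply _ _
  have hw' : ∀ j, W (Sum.inr j) (Sum.inl ()) = wvec W j := fun j => rfl
  simp only [Fintype.sum_sum_type, Finset.univ_unique, Finset.sum_singleton,
    Finset.sum_add_distrib, PUnit.default_eq_unit, h0, hw, hw', dotProduct, Finset.mul_sum,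
    Function.comp, toBlocks₂₂, of_apply]
  have : ∀ j, 2 * θ (Sum.inl ()) * (wvec W j * θ (Sum.inr j)) =
    wvec W j * θ (Sum.inl ()) * θ (Sum.inr j) + wvec W j * θ (Sum.inr j) * θ (Sum.inl ()) :=
    fun j => by ring
  simp only [this, Finset.sum_add_distrib]
  ring

lemma measurable_integrand {V : Type*} [Fintype V] [DecidableEq V] (W : Matrix V V ℝ)
    (θ η : V → ℝ) : Measurable fun β : V → ℝ => ENNReal.ofReal
      (Real.exp (-(∑ i, θ i ^ 2 * β i) - 1/2 * (η ⬝ᵥ ((Hmat W β)⁻¹ *ᵥ η))) /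
        Real.sqrt (Hmat W β).det) := by
  have h1 := measurable_quad W η η
  have h2 := measurable_det W
  fun_prop

lemma key_step {U : Type*} [Fintype U] [DecidableEq U] (h : KeyStmt U) : KeyStmt (Unit ⊕ U) := by
  intro W hs hnn hd θ η hθ hη
  have h0 := hd (Sum.inl ())
  have hsU : W.toBlocks₂₂.IsSymm := by
    ext i j; exact hs.apply _ _
  set t := θ (Sum.inl ()) with ht
  have htpos : 0 < t := hθ _
  set p := η (Sum.inl ()) with hp
  set θU : U → ℝ := θ ∘ Sum.inr with hθU
  set q : U → ℝ := η ∘ Sum.inr with hq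
  have hη' : η = Sum.elim (fun _ => p) q := by
    ext i; rcases i with i | i <;> rfl
  have hwnn : ∀ j, 0 ≤ wvec W j := fun j => hnn _ _
  have hqnn : ∀ j, 0 ≤ q j := fun j => hη _
  have h1 := h W.toBlocks₂₂ hsU (fun i j => hnn _ _) (fun i => hd _) θU
    (q + t • wvec W) (fun i => hθ _)
    (fun i => by have := hwnn i; have := hqnn i; simp only [Pi.add_apply, Pi.smul_apply, smul_eq_mul]; positivity)
  rw [one_step W hs h0 _ (measurable_integrand W θ η)]
  have hstep : ∀ y : U → ℝ, {y | (Hmat W.toBlocks₂₂ y).PosDef}.indicator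
        (fun y => ∫⁻ s in Set.Ioi (0:ℝ), ENNReal.ofReal (1/2) * ENNReal.ofReal
      (Real.exp (-(∑ i, θ i ^ 2 * (Sum.elim (fun _ => (s + cS W y) / 2) y : Unit ⊕ U → ℝ) i) -
        1/2 * (η ⬝ᵥ ((Hmat W (Sum.elim (fun _ => (s + cS W y) / 2) y))⁻¹ *ᵥ η))) /
        Real.sqrt (Hmat W (Sum.elim (fun _ => (s + cS W y) / 2) y)).det)) y =
      ENNReal.ofReal (Real.sqrt (Real.pi / 2) / t * Real.exp (-(t * p))) *
      {y | (Hmat W.toBlocks₂₂ y).PosDef}.indicator (fun y => ENNReal.ofReal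
      (Real.exp (-(∑ i, θU i ^ 2 * y i) - 1/2 * ((q + t • wvec W) ⬝ᵥ
        ((Hmat W.toBlocks₂₂ y)⁻¹ *ᵥ (q + t • wvec W)))) /
        Real.sqrt (Hmat W.toBlocks₂₂ y).det)) y := by
    intro y
    by_cases hD : (Hmat W.toBlocks₂₂ y).PosDef
    swap
    · rw [Set.indicator_of_notMem (by exact hD), Set.indicator_of_notMem (by exact hD), mul_zero]
    rw [Set.indicator_of_mem (by exact hD), Set.indicator_of_mem (by exact hD)]
    set b := p + wvec W ⬝ᵥ ((Hmat W.toBlocks₂₂ y)⁻¹ *ᵥ q) with hb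
    have hbnn : 0 ≤ b := by
      have h3 : 0 ≤ wvec W ⬝ᵥ ((Hmat W.toBlocks₂₂ y)⁻¹ *ᵥ q) :=
        Finset.sum_nonneg fun i _ => mul_nonneg (hwnn i)
          (inv_nonneg_of_M W.toBlocks₂₂ (fun i j => hnn _ _) y hD q hqnn i)
      have : 0 ≤ p := hη _
      linarith
    have hdet := hD.det_pos
    have hIG := aux_IG t b htpos hbnn
    set Q := q ⬝ᵥ ((Hmat W.toBlocks₂₂ y)⁻¹ *ᵥ q) with hQ
    set A := Real.exp (-(1/2) * t^2 * cS W y - (∑ i, θU i ^ 2 * y i) - 1/2 * Q) /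
      Real.sqrt (Hmat W.toBlocks₂₂ y).det with hA
    have hApos : 0 ≤ A := by positivity
    trans ENNReal.ofReal A * ∫⁻ s in Set.Ioi (0:ℝ), ENNReal.ofReal (1/2) *
        ENNReal.ofReal (Real.exp (-(1/2) * (t^2 * s + b^2 / s)) / Real.sqrt s)
    · rw [← lintegral_const_mul' _ _ ENNReal.ofReal_ne_top]
      apply setLIntegral_congr_fun measurableSet_Ioi
      intro s hs'
      have hspos : 0 < s := hs'
      have e1 : 2 * ((s + cS W y) / 2) - cS W y = s := by ring
      have hquad : η ⬝ᵥ ((Hmat W (Sum.elim (fun _ => (s + cS W y) / 2) y))⁻¹ *ᵥ η) =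
          Q + b^2 / s := by
        rw [hη', Hmat_inv_mulVec W hs h0 _ y hD (by rw [e1]; exact hspos), e1, ← hb,
          sumElim_dotProduct_sumElim, dotProduct_add, dotProduct_smul, ← hQ,
          quad_symm _ hsU y q (wvec W)]
        simp only [dotProduct, Finset.univ_unique, Finset.sum_singleton, smul_eq_mul]
        change p * (b/s) + (Q + b/s * (wvec W ⬝ᵥ ((Hmat W.toBlocks₂₂ y)⁻¹ *ᵥ q))) = _
        rw [show wvec W ⬝ᵥ ((Hmat W.toBlocks₂₂ y)⁻¹ *ᵥ q) = b - p by rw [hb]; ring]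
        ring
      simp only
      rw [hquad, Hmat_det W hs h0 _ y hD, e1, Fintype.sum_sum_type]
      simp only [Finset.univ_unique, Finset.sum_singleton, PUnit.default_eq_unit, Sum.elim_inl,
        Sum.elim_inr]
      rw [← ENNReal.ofReal_mul (by positivity), ← ENNReal.ofReal_mul (by positivity),
        ← ENNReal.ofReal_mul (by positivity)]
      congr 1
      rw [Real.sqrt_mul hdet.le, hA]
      rw [show -(θ (Sum.inl ()) ^ 2 * ((s + cS W y) / 2) + ∑ x, θ (Sum.inr x) ^ 2 * y x) -
        1 / 2 * (Q + b ^ 2 / s) = (-(1/2) * t^2 * cS W y - (∑ i, θU i ^ 2 * y i) - 1/2 * Q) +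
          (-(1/2) * (t^2 * s + b^2 / s)) by
          simp only [hθU, ht, Function.comp]; ring, Real.exp_add]
      ring
    · rw [hIG, ← ENNReal.ofReal_mul (by positivity), ← ENNReal.ofReal_mul (by positivity)]
      congr 1
      have hexp : (q + t • wvec W) ⬝ᵥ ((Hmat W.toBlocks₂₂ y)⁻¹ *ᵥ (q + t • wvec W)) =
          Q + 2 * t * (b - p) + t^2 * cS W y := by
        rw [mulVec_add, mulVec_smul, dotProduct_add, add_dotProduct, add_dotProduct,
          dotProduct_smul, smul_dotProduct, smul_dotProduct, dotProduct_smul,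
          quad_symm _ hsU y q (wvec W), ← hQ, cS, hb]
        simp only [smul_eq_mul]
        ring
      rw [hexp, hA]
      have : ∀ x1 x2 x3 x4 d u: ℝ, x1 + x2 = x3 + x4 → Real.exp x1 / d * (u * Real.exp x2) =
        u * Real.exp x3 * (Real.exp x4 / d) := by
        intro x1 x2 x3 x4 d u hx
        have : Real.exp x1 * Real.exp x2 = Real.exp x3 * Real.exp x4 := by
          rw [← Real.exp_add, ← Real.exp_add, hx]
        calc _ = u * (Real.exp x1 * Real.exp x2) / d := by ring
          _ = _ := by rw [this]; ring
      apply this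
      ring
  rw [lintegral_congr hstep, lintegral_const_mul' _ _ ENNReal.ofReal_ne_top, h1,
    ← ENNReal.ofReal_mul (by positivity)]
  congr 1
  have hprod : (∏ i, θ i) = t * ∏ i, θU i := by
    simp [Fintype.prod_sum_type, ht, hθU]
  have hc : Fintype.card (Unit ⊕ U) = Fintype.card U + 1 := by simp [add_comm]
  rw [hprod, hc, sum_split W hs h0]
  have hηθ : η ⬝ᵥ θ = p * t + q ⬝ᵥ θU := by
    simp [dotProduct, Fintype.sum_sum_type, hp, hq, ht, hθU]
  rw [hηθ, add_dotProduct, smul_dotProduct, smul_eq_mul, pow_succ, mul_inv, ← ht, ← hθU]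
  set R := ∑ i, ∑ j, W.toBlocks₂₂ i j * θU i * θU j
  have : Real.exp (-(1 / 2) * (2 * t * wvec W ⬝ᵥ θU + R) - (p * t + q ⬝ᵥ θU)) =
    Real.exp (-(t * p)) * Real.exp (-(1 / 2) * R - (q ⬝ᵥ θU + t * wvec W ⬝ᵥ θU)) := by
    rw [← Real.exp_add]; congr 1; ring
  rw [this]
  ring

lemma key_empty (V : Type*) [Fintype V] [DecidableEq V] [IsEmpty V] : KeyStmt V := by
  intro W hs hnn hd θ η hθ hη
  have : ∀ β : V → ℝ, (Hmat W β).PosDef := by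
    intro β
    apply PosDef.of_dotProduct_mulVec_pos (Hmat_isHermitian W hs β)
    intro x hx
    exact absurd (Subsingleton.elim x 0) hx
  have h2 : {β : V → ℝ | (Hmat W β).PosDef} = Set.univ := Set.eq_univ_of_forall this
  rw [h2]
  have h3 : (volume : Measure (V → ℝ)) Set.univ = 1 := by
    rw [volume_pi, Measure.pi_of_empty (x := fun i => isEmptyElim i)]
    simp
  simp [h3]

lemma key_all (V : Type*) [Fintype V] [DecidableEq V] : KeyStmt V := by
  have h : ∀ [DecidableEq V], KeyStmt V := by
    refine Fintype.induction_empty_option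
      (P := fun (α : Type _) [Fintype α] => ∀ [DecidableEq α], KeyStmt α) ?_ ?_ ?_ V
    · intro α β _ e h _
      classical
      let := Fintype.ofEquiv _ e.symm
      exact key_equiv e.symm h
    · intro hd
      exact key_empty _
    · intro α _ h _
      classical
      exact key_equiv ((Equiv.optionEquivSumPUnit α).trans (Equiv.sumComm _ _)) (key_step h)
  exact h

end key

section core

lemma measurable_core {V : Type*} [Fintype V] [DecidableEq V] (W : Matrix V V ℝ) (i₀ : V)
    (θ : V → ℝ) : Measurable fun β : V → ℝ => ENNReal.ofReal
      (Real.exp (-(∑ i, θ i ^ 2 * β i) + (θ i₀ ^ 2 - 1) / (2 * (Hmat W β)⁻¹ i₀ i₀)) /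
        Real.sqrt (Hmat W β).det) := by
  have h1 := measurable_inv W i₀ i₀
  have h2 := measurable_det W
  refine (Measurable.div (Measurable.exp (Measurable.add ?_ ?_)) h2.sqrt).ennreal_ofReal
  · fun_prop
  · exact (h1.const_mul 2).const_div _

lemma core_step {U : Type*} [Fintype U] [DecidableEq U] (W : Matrix (Unit ⊕ U) (Unit ⊕ U) ℝ)
    (hs : W.IsSymm) (hnn : ∀ i j, 0 ≤ W i j) (hd : ∀ i, W i i = 0)
    (θ : Unit ⊕ U → ℝ) (hθ : ∀ i, 0 < θ i) :
    ∫⁻ β, {β | (Hmat W β).PosDef}.indicator (fun β => ENNReal.ofReal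
      (Real.exp (-(∑ i, θ i ^ 2 * β i) + (θ (Sum.inl ()) ^ 2 - 1) /
          (2 * (Hmat W β)⁻¹ (Sum.inl ()) (Sum.inl ()))) /
        Real.sqrt (Hmat W β).det)) β
      = ENNReal.ofReal (Real.sqrt (Real.pi / 2) ^ (Fintype.card U + 1) *
          (∏ i, θ (Sum.inr i))⁻¹ *
          Real.exp (-(1/2) * (∑ i, ∑ j, W i j * θ i * θ j))) := by
  have h0 := hd (Sum.inl ())
  have hsU : W.toBlocks₂₂.IsSymm := by
    ext i j; exact hs.apply _ _
  set t := θ (Sum.inl ()) with ht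
  have htpos : 0 < t := hθ _
  set θU : U → ℝ := θ ∘ Sum.inr with hθU
  have hwnn : ∀ j, 0 ≤ wvec W j := fun j => hnn _ _
  have h1 := key_all U W.toBlocks₂₂ hsU (fun i j => hnn _ _) (fun i => hd _) θU
    (t • wvec W) (fun i => hθ _)
    (fun i => by have := hwnn i; simp only [Pi.smul_apply, smul_eq_mul]; positivity)
  rw [one_step W hs h0 _ (measurable_core W (Sum.inl ()) θ)]
  have hstep : ∀ y : U → ℝ, {y | (Hmat W.toBlocks₂₂ y).PosDef}.indicator
        (fun y => ∫⁻ s in Set.Ioi (0:ℝ), ENNReal.ofReal (1/2) * ENNReal.ofReal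
      (Real.exp (-(∑ i, θ i ^ 2 * (Sum.elim (fun _ => (s + cS W y) / 2) y : Unit ⊕ U → ℝ) i) +
        (t ^ 2 - 1) /
          (2 * (Hmat W (Sum.elim (fun _ => (s + cS W y) / 2) y))⁻¹ (Sum.inl ()) (Sum.inl ()))) /
        Real.sqrt (Hmat W (Sum.elim (fun _ => (s + cS W y) / 2) y)).det)) y =
      ENNReal.ofReal (Real.sqrt (Real.pi / 2)) *
      {y | (Hmat W.toBlocks₂₂ y).PosDef}.indicator (fun y => ENNReal.ofReal
      (Real.exp (-(∑ i, θU i ^ 2 * y i) - 1/2 * ((t • wvec W) ⬝ᵥ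
        ((Hmat W.toBlocks₂₂ y)⁻¹ *ᵥ (t • wvec W)))) /
        Real.sqrt (Hmat W.toBlocks₂₂ y).det)) y := by
    intro y
    by_cases hD : (Hmat W.toBlocks₂₂ y).PosDef
    swap
    · rw [Set.indicator_of_notMem (by exact hD), Set.indicator_of_notMem (by exact hD), mul_zero]
    rw [Set.indicator_of_mem (by exact hD), Set.indicator_of_mem (by exact hD)]
    have hdet := hD.det_pos
    have hIG := aux_IG 1 0 one_pos le_rfl
    simp only [mul_zero, neg_zero, Real.exp_zero, mul_one, div_one] at hIG
    rw [← hIG, mul_comm, ← lintegral_const_mul' _ _ ENNReal.ofReal_ne_top]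
    apply setLIntegral_congr_fun measurableSet_Ioi
    intro s hs'
    have hspos : 0 < s := hs'
    have e1 : 2 * ((s + cS W y) / 2) - cS W y = s := by ring
    have hinv : (Hmat W (Sum.elim (fun _ => (s + cS W y) / 2) y))⁻¹ (Sum.inl ()) (Sum.inl ()) =
          1 / s := by
      have h3 := congrFun (Hmat_inv_mulVec W hs h0 _ y hD (by rw [e1]; exact hspos) 1 0)
        (Sum.inl ())
      rw [e1] at h3
      have h4 : (Sum.elim (fun _ => (1:ℝ)) (0 : U → ℝ)) = Pi.single (Sum.inl ()) 1 := by
        ext i; rcases i with i | i <;> simp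
      rw [h4, mulVec_single_one] at h3
      simpa using h3
    have hquad : (t • wvec W) ⬝ᵥ ((Hmat W.toBlocks₂₂ y)⁻¹ *ᵥ (t • wvec W)) = t^2 * cS W y := by
      rw [mulVec_smul, dotProduct_smul, smul_dotProduct, cS]
      simp only [smul_eq_mul]; ring
    simp only
    rw [hquad, hinv, Hmat_det W hs h0 _ y hD, e1, Fintype.sum_sum_type]
    simp only [Finset.univ_unique, Finset.sum_singleton, PUnit.default_eq_unit, Sum.elim_inl,
        Sum.elim_inr]
    rw [← ENNReal.ofReal_mul (by positivity), ← ENNReal.ofReal_mul (by positivity),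
        ← ENNReal.ofReal_mul (by positivity)]
    congr 1
    rw [Real.sqrt_mul hdet.le]
    rw [show -(θ (Sum.inl ()) ^ 2 * ((s + cS W y) / 2) + ∑ x, θ (Sum.inr x) ^ 2 * y x) +
        (t ^ 2 - 1) / (2 * (1 / s)) = (-(∑ i, θU i ^ 2 * y i) - 1/2 * (t^2 * cS W y)) +
          (-(1/2) * (1^2 * s + 0^2 / s)) by
          simp only [hθU, ← ht, Function.comp]; field_simp; ring, Real.exp_add]
    ring
  rw [lintegral_congr hstep, lintegral_const_mul' _ _ ENNReal.ofReal_ne_top, h1,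
    ← ENNReal.ofReal_mul (by positivity)]
  congr 1
  rw [sum_split W hs h0, smul_dotProduct, smul_eq_mul, pow_succ, ← ht, ← hθU]
  set R := ∑ i, ∑ j, W.toBlocks₂₂ i j * θU i * θU j
  rw [show -(1 / 2) * (2 * t * wvec W ⬝ᵥ θU + R) = -(1 / 2) * R - t * wvec W ⬝ᵥ θU by ring]
  simp only [hθU, Function.comp]
  ring

lemma core_all {V : Type*} [Fintype V] [DecidableEq V] (W : Matrix V V ℝ)
    (hs : W.IsSymm) (hnn : ∀ i j, 0 ≤ W i j) (hd : ∀ i, W i i = 0) (i₀ : V)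
    (θ : V → ℝ) (hθ : ∀ i, 0 < θ i) :
    ∫⁻ β, {β | (Hmat W β).PosDef}.indicator (fun β => ENNReal.ofReal
      (Real.exp (-(∑ i, θ i ^ 2 * β i) + (θ i₀ ^ 2 - 1) / (2 * (Hmat W β)⁻¹ i₀ i₀)) /
        Real.sqrt (Hmat W β).det)) β
      = ENNReal.ofReal (Real.sqrt (Real.pi / 2) ^ (Fintype.card V) *
          (∏ i ∈ Finset.univ \ {i₀}, θ i)⁻¹ *
          Real.exp (-(1/2) * (∑ i, ∑ j, W i j * θ i * θ j))) := by
  let e : V ≃ Unit ⊕ {i // i ≠ i₀} := (Equiv.optionSubtypeNe i₀).symm.trans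
    ((Equiv.optionEquivSumPUnit _).trans (Equiv.sumComm _ _))
  have he : e i₀ = Sum.inl () := by simp [e]
  have he' : e.symm (Sum.inl ()) = i₀ := by rw [← he]; simp
  have h1 := core_step (W.submatrix e.symm e.symm) (hs.submatrix _) (fun i j => hnn _ _)
    (fun i => hd _) (θ ∘ e.symm) (fun i => hθ _)
  rw [lintegral_equiv e]
  convert! h1 using 1
  · congr 1
    ext β'
    by_cases hp : (Hmat (W.submatrix e.symm e.symm) β').PosDef
    · have hp' : (Hmat W (fun i => β' (e i))).PosDef := by
        rw [Hmat_equiv, posDef_equiv]; exact hp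
      rw [Set.indicator_of_mem (by exact hp'), Set.indicator_of_mem (by exact hp), Hmat_equiv,
        det_submatrix_equiv_self, inv_submatrix_equiv, submatrix_apply, he, Function.comp, he']
      congr 5
      exact Fintype.sum_equiv e _ _ (fun i => by simp)
    · have hp' : ¬ (Hmat W (fun i => β' (e i))).PosDef := by
        rw [Hmat_equiv, posDef_equiv]; exact hp
      rw [Set.indicator_of_notMem (by exact hp'), Set.indicator_of_notMem (by exact hp)]
  · congr 2
    · have hc : Fintype.card V = Fintype.card {i // i ≠ i₀} + 1 := by
        rw [Fintype.card_congr e]; simp [add_comm]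
      rw [hc]
      congr 2
      have hp1 : ∏ i, θ i = θ i₀ * ∏ i ∈ Finset.univ \ {i₀}, θ i := by
        rw [Finset.sdiff_singleton_eq_erase, Finset.mul_prod_erase _ _ (Finset.mem_univ _)]
      have hp2 : ∏ i, θ i = θ i₀ * ∏ i, (θ ∘ e.symm) (Sum.inr i) := by
        rw [Fintype.prod_equiv e θ (θ ∘ e.symm) (fun i => by simp), Fintype.prod_sum_type]
        simp [he']
      exact mul_left_cancel₀ (hθ i₀).ne' (hp1.symm.trans hp2)
    · congr 2
      exact Fintype.sum_equiv e _ _ (fun i => Fintype.sum_equiv e _ _ (fun j => by simp))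

end core

lemma measurable_nuDens {V : Type*} [Fintype V] [DecidableEq V] (W : Matrix V V ℝ)
    (hs : W.IsSymm) : Measurable (nuDens W 0) := by
  refine Measurable.indicator ?_ (measurableSet_posDef W hs)
  have h1 := measurable_quad W 0 0
  have h2 := measurable_det W
  have h3 : Measurable fun β : V → ℝ => (1 : V → ℝ) ⬝ᵥ (Hmat W β).mulVec 1 :=
    (continuous_const.dotProduct ((Hmat_continuous W).matrix_mulVec continuous_const)).measurable
  fun_prop

lemma measurable_test {V : Type*} [Fintype V] [DecidableEq V] (W : Matrix V V ℝ)
    (i₀ : V) (l : V → ℝ) : Measurable fun β : V → ℝ => Real.exp (-(l ⬝ᵥ fun i =>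
          β i - if i = i₀ then 1 / (2 * (Hmat W β)⁻¹ i₀ i₀) else 0)) := by
  have h1 := measurable_inv W i₀ i₀
  simp only [dotProduct]
  refine (Finset.measurable_sum _ fun i _ => ?_).neg.exp
  refine Measurable.const_mul (Measurable.sub (measurable_pi_apply i) ?_) _
  split_ifs
  · exact (h1.const_mul 2).const_div _
  · exact measurable_const

theorem stmt8 {V : Type*} [Fintype V] [DecidableEq V] [Nonempty V]
    (W : Matrix V V ℝ) (hsymm : W.IsSymm) (hnn : ∀ i j, 0 ≤ W i j)
    (hdiag : ∀ i, W i i = 0) (hconn : (graphOf W).Connected)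
    (i₀ : V) (l : V → ℝ) (hl : ∀ i, 0 ≤ l i) :
    ∫ β, Real.exp (-(l ⬝ᵥ fun i =>
          β i - if i = i₀ then 1 / (2 * (Hmat W β)⁻¹ i₀ i₀) else 0)) ∂(nuMeas W 0)
      = Real.exp (-(1 / 2) * ∑ i, ∑ j,
            if i = j then 0
            else W i j * (Real.sqrt ((1 + l i) * (1 + l j)) - 1))
          * ∏ i ∈ Finset.univ \ {i₀}, (1 + l i) ^ (-(1 / 2) : ℝ) := by
  have hlint : ∫⁻ β, ENNReal.ofReal (Real.exp (-(l ⬝ᵥ fun i =>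
          β i - if i = i₀ then 1 / (2 * (Hmat W β)⁻¹ i₀ i₀) else 0))) ∂(nuMeas W 0) =
      ENNReal.ofReal (Real.exp (-(1 / 2) * ∑ i, ∑ j,
            if i = j then 0
            else W i j * (Real.sqrt ((1 + l i) * (1 + l j)) - 1))
          * ∏ i ∈ Finset.univ \ {i₀}, (1 + l i) ^ (-(1 / 2) : ℝ)) := by
    set θ : V → ℝ := fun i => Real.sqrt (1 + l i) with hθ
    have hθpos : ∀ i, 0 < θ i := fun i => Real.sqrt_pos.2 (by have := hl i; linarith)
    have hθsq : ∀ i, θ i ^ 2 = 1 + l i := fun i => Real.sq_sqrt (by have := hl i; linarith)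
    have hcore := core_all W hsymm hnn hdiag i₀ θ hθpos
    rw [nuMeas, lintegral_withDensity_eq_lintegral_mul _ (measurable_nuDens W hsymm)
      (measurable_test W i₀ l).ennreal_ofReal]
    set K := (2 / Real.pi) ^ ((Fintype.card V : ℝ) / 2) with hK
    have hKpos : 0 < K := by positivity
    set S := ∑ i, ∑ j, W i j with hS
    have hpt : ∀ β : V → ℝ, (nuDens W 0 * fun β => ENNReal.ofReal (Real.exp (-(l ⬝ᵥ fun i =>
          β i - if i = i₀ then 1 / (2 * (Hmat W β)⁻¹ i₀ i₀) else 0)))) β =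
        ENNReal.ofReal (K * Real.exp (1/2 * S)) *
        {β | (Hmat W β).PosDef}.indicator (fun β => ENNReal.ofReal
      (Real.exp (-(∑ i, θ i ^ 2 * β i) + (θ i₀ ^ 2 - 1) / (2 * (Hmat W β)⁻¹ i₀ i₀)) /
        Real.sqrt (Hmat W β).det)) β := by
      intro β
      rw [Pi.mul_apply, nuDens]
      by_cases hp : (Hmat W β).PosDef
      swap
      · rw [Set.indicator_of_notMem (by exact hp), Set.indicator_of_notMem (by exact hp)]; simp
      rw [Set.indicator_of_mem (by exact hp), Set.indicator_of_mem (by exact hp),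
        ← ENNReal.ofReal_mul (by positivity), ← ENNReal.ofReal_mul (by positivity)]
      congr 1
      have h1 : (1 : V → ℝ) ⬝ᵥ (Hmat W β).mulVec 1 = 2 * ∑ i, β i - S := by
        simp only [dotProduct, mulVec, Hmat_apply, Pi.one_apply, one_mul, mul_one,
          Finset.sum_sub_distrib, Finset.sum_ite_eq, Finset.mem_univ, if_true, hS, Finset.mul_sum]
      have h2 : (l ⬝ᵥ fun i => β i - if i = i₀ then 1 / (2 * (Hmat W β)⁻¹ i₀ i₀) else 0) =
          ∑ i, l i * β i - l i₀ / (2 * (Hmat W β)⁻¹ i₀ i₀) := by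
        simp only [dotProduct, mul_sub, Finset.sum_sub_distrib, mul_ite, mul_zero,
          Finset.sum_ite_eq', Finset.mem_univ, if_true]
        ring
      have h3 : ∑ i, θ i ^ 2 * β i = ∑ i, β i + ∑ i, l i * β i := by
        rw [← Finset.sum_add_distrib]
        exact Finset.sum_congr rfl fun i _ => by rw [hθsq]; ring
      rw [h1, h2, h3, hθsq]
      simp only [zero_dotProduct, add_zero]
      rw [show (1 + l i₀ - 1) = l i₀ by ring]
      set g := l i₀ / (2 * (Hmat W β)⁻¹ i₀ i₀)
      have h4 : Real.exp (-(1 / 2) * (2 * ∑ i, β i - S)) * Real.exp (-(∑ i, l i * β i - g)) =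
          Real.exp (1/2 * S) * Real.exp (-(∑ i, β i + ∑ i, l i * β i) + g) := by
        rw [← Real.exp_add, ← Real.exp_add]; congr 1; ring
      calc _ = K * (Real.exp (-(1 / 2) * (2 * ∑ i, β i - S)) *
            Real.exp (-(∑ i, l i * β i - g))) / Real.sqrt (Hmat W β).det := by ring
        _ = _ := by rw [h4]; ring
    rw [lintegral_congr hpt, lintegral_const_mul' _ _ ENNReal.ofReal_ne_top, hcore,
      ← ENNReal.ofReal_mul (by positivity)]
    congr 1
    have hKc : K * Real.sqrt (Real.pi / 2) ^ Fintype.card V = 1 := by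
      rw [hK, Real.sqrt_eq_rpow, ← Real.rpow_natCast, ← Real.rpow_mul (by positivity),
        show (1/2 : ℝ) * (Fintype.card V : ℝ) = (Fintype.card V : ℝ) / 2 by ring,
        ← Real.mul_rpow (by positivity) (by positivity)]
      rw [show 2 / Real.pi * (Real.pi / 2) = 1 by field_simp, Real.one_rpow]
    have hprod : (∏ i ∈ Finset.univ \ {i₀}, θ i)⁻¹ =
        ∏ i ∈ Finset.univ \ {i₀}, (1 + l i) ^ (-(1 / 2) : ℝ) := by
      rw [← Finset.prod_inv_distrib]
      refine Finset.prod_congr rfl fun i _ => ?_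
      rw [hθ, Real.rpow_neg (by have := hl i; linarith), ← Real.sqrt_eq_rpow]
    have hsum : (∑ i, ∑ j, if i = j then 0
            else W i j * (Real.sqrt ((1 + l i) * (1 + l j)) - 1)) =
        (∑ i, ∑ j, W i j * θ i * θ j) - S := by
      rw [hS, ← Finset.sum_sub_distrib]
      refine Finset.sum_congr rfl fun i _ => ?_
      rw [← Finset.sum_sub_distrib]
      refine Finset.sum_congr rfl fun j _ => ?_
      split_ifs with h
      · subst h; simp [hdiag]
      · rw [Real.sqrt_mul (by have := hl i; linarith)]; simp only [hθ]; ring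
    rw [hprod, hsum, mul_sub, sub_eq_add_neg, Real.exp_add]
    rw [show -(-(1 / 2) * S) = 1 / 2 * S by ring]
    calc _ = (K * Real.sqrt (Real.pi / 2) ^ Fintype.card V) *
          (Real.exp (-(1 / 2) * ∑ i, ∑ j, W i j * θ i * θ j) * Real.exp (1 / 2 * S) *
        ∏ i ∈ Finset.univ \ {i₀}, (1 + l i) ^ (-(1 / 2) : ℝ)) := by ring
      _ = _ := by rw [hKc, one_mul]
  rw [integral_eq_lintegral_of_nonneg_ae (Filter.Eventually.of_forall fun β => (Real.exp_pos _).le)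
    (measurable_test W i₀ l).aestronglyMeasurable, hlint, ENNReal.toReal_ofReal]
  refine mul_nonneg (Real.exp_pos _).le (Finset.prod_nonneg fun i _ => ?_)
  exact Real.rpow_nonneg (by have := hl i; linarith) _

end
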